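/- arXiv:2401.14390 — 3 statements merged into one kernel-verified Lean document; each statement's English description precedes it below -/
import Mathlib

section
/- For every integer N ≥ 1 there exists a polynomial f_N in four variables with real, nonnegative coefficients, depending only on N, such that for all a, b, λ, T > 0 the sequence (H_h) defined from the inverse Gaussian cumulant function satisfies |H_N| ≤ (a·T/(λ·b^{N+1})) · f_N(a, 1/λ, 1/b, T). -/
/-- The sequence `φ_n` appearing in the derivatives of the inverse Gaussian cumulant
function: `φ_1 = 1` and `φ_n = (2n−3)·φ_{n−1} + (2n−3)!!` for `n ≥ 2`. -/
noncomputable def varphi : ℕ → ℝ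
  | 0 => 0
  | 1 => 1
  | (n + 2) => ((2 * (n + 2) - 3 : ℕ) : ℝ) * varphi (n + 1) +
      ((2 * (n + 2) - 3 : ℕ).doubleFactorial : ℝ)

theorem varphi_nonneg : ∀ n, 0 ≤ varphi n
  | 0 => le_rfl
  | 1 => zero_le_one
  | (n + 2) => by
    have := varphi_nonneg (n + 1)
    rw [varphi]
    positivity

theorem integral_exp_neg_mul {c : ℝ} (hc : c ≠ 0) (T : ℝ) :
    ∫ s in (0 : ℝ)..T, Real.exp (-(c * s)) = (1 - Real.exp (-(c * T))) / c := by
  have hderiv : ∀ s ∈ Set.uIcc 0 T,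
      HasDerivAt (fun s => -Real.exp (-(c * s)) / c) (Real.exp (-(c * s))) s := by
    intro s _
    have h := ((((hasDerivAt_id s).const_mul c).neg.exp).neg).div_const c
    refine h.congr_deriv ?_
    simp only [id, mul_one]
    rw [mul_neg, neg_neg, mul_div_cancel_right₀ _ hc]
    rfl
  rw [intervalIntegral.integral_eq_sub_of_hasDerivAt hderiv
    (Continuous.intervalIntegrable (by fun_prop) _ _)]
  simp only [mul_zero, neg_zero, Real.exp_zero]
  ring

/-- The combination of the `α_{0,jT}` occurring in the recursion is the integral of
`(1 - e^{-λs})^n` over `[0, T]`. -/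
theorem add_sum_eq_integral_one_sub_exp_pow {lam : ℝ} (hlam : 0 < lam) (T : ℝ) (n : ℕ) :
    T + ∑ j ∈ Finset.Icc 1 n, (1 / (j : ℝ)) * (Nat.choose n j : ℝ) * (-1 : ℝ) ^ j *
        ((1 - Real.exp (-(lam * ((j : ℝ) * T)))) / lam) =
      ∫ s in (0 : ℝ)..T, (1 - Real.exp (-(lam * s))) ^ n := by
  have hexpand : ∀ s : ℝ, (1 - Real.exp (-(lam * s))) ^ n =
      1 + ∑ j ∈ Finset.Icc 1 n,
        (Nat.choose n j : ℝ) * (-1 : ℝ) ^ j * Real.exp (-((lam * j) * s)) := by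
    intro s
    have hterm : ∀ j : ℕ, (-Real.exp (-(lam * s))) ^ j * 1 ^ (n - j) * (Nat.choose n j : ℝ) =
        (Nat.choose n j : ℝ) * (-1 : ℝ) ^ j * Real.exp (-((lam * j) * s)) := by
      intro j
      rw [neg_pow, ← Real.exp_nat_mul, one_pow,
        show (j : ℝ) * -(lam * s) = -((lam * j) * s) by ring]
      ring
    rw [sub_eq_neg_add, add_pow, Finset.sum_congr rfl fun j _ => hterm j,
      Finset.range_eq_Ico, Finset.sum_eq_sum_Ico_succ_bot (Nat.succ_pos n)]
    simp [Finset.Ico_add_one_right_eq_Icc]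
  simp_rw [hexpand]
  rw [intervalIntegral.integral_add (by simp)
    (Continuous.intervalIntegrable (by fun_prop) _ _),
    intervalIntegral.integral_finsetSum
      fun j _ => Continuous.intervalIntegrable (by fun_prop) _ _]
  congr 1
  · simp
  · refine Finset.sum_congr rfl fun j hj => ?_
    have hj0 : (j : ℝ) ≠ 0 := by
      have := (Finset.mem_Icc.mp hj).1
      positivity
    rw [intervalIntegral.integral_const_mul, integral_exp_neg_mul (mul_ne_zero hlam.ne' hj0),
      mul_assoc lam]
    field_simp

theorem abs_integral_one_sub_exp_pow_le {lam T : ℝ} (hlam : 0 < lam) (hT : 0 < T) (n : ℕ) :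
    |∫ s in (0 : ℝ)..T, (1 - Real.exp (-(lam * s))) ^ n| ≤ T := by
  have h := intervalIntegral.norm_integral_le_of_norm_le_const (a := 0) (b := T) (C := 1)
    (f := fun s => (1 - Real.exp (-(lam * s))) ^ n) (by
      intro s hs
      rw [Set.uIoc_of_le hT.le] at hs
      have hexp : Real.exp (-(lam * s)) ≤ 1 :=
        Real.exp_le_one_iff.mpr (by nlinarith [hs.1])
      rw [norm_pow]
      refine pow_le_one₀ (norm_nonneg _) ?_
      rw [Real.norm_eq_abs, abs_le]
      constructor <;> linarith [Real.exp_pos (-(lam * s))])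
  simpa [abs_of_pos hT] using h

namespace MvPolynomial

variable {σ : Type*}

theorem coeff_mul_nonneg {p q : MvPolynomial σ ℝ} (hp : ∀ m, 0 ≤ coeff m p)
    (hq : ∀ m, 0 ≤ coeff m q) (m : σ →₀ ℕ) : 0 ≤ coeff m (p * q) := by
  classical
  rw [coeff_mul]
  exact Finset.sum_nonneg fun x _ => mul_nonneg (hp _) (hq _)

theorem coeff_C_nonneg {r : ℝ} (hr : 0 ≤ r) (m : σ →₀ ℕ) :
    0 ≤ coeff m (C r : MvPolynomial σ ℝ) := by
  classical
  rw [coeff_C]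
  split_ifs <;> simp [hr]

theorem coeff_X_nonneg (i : σ) (m : σ →₀ ℕ) : 0 ≤ coeff m (X i : MvPolynomial σ ℝ) := by
  classical
  rw [coeff_X]
  split_ifs <;> simp

theorem coeff_pow_nonneg {p : MvPolynomial σ ℝ} (hp : ∀ m, 0 ≤ coeff m p) (n : ℕ) :
    ∀ m, 0 ≤ coeff m (p ^ n) := by
  induction n with
  | zero => simpa using coeff_C_nonneg (σ := σ) zero_le_one
  | succ n ih => exact pow_succ p n ▸ coeff_mul_nonneg ih hp

end MvPolynomial

open MvPolynomial in
/-- A polynomial in `(a, 1/λ, 1/b, T)` whose value divided by `b ^ N` dominates the `N`-th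
central moment. -/
noncomputable def momentPoly : ℕ → MvPolynomial (Fin 4) ℝ
  | 0 => 1
  | n + 1 => X 0 * X 1 * X 2 * X 3 *
      ∑ i : Fin n, C ((n.choose (i + 1) : ℝ) * varphi (i + 2)) * (X 1 * X 2) ^ (i : ℕ) *
        momentPoly (n - 1 - i)
  decreasing_by omega

open MvPolynomial in
/-- The polynomial bounding the central moment of order `n + 1`. -/
noncomputable def momentBoundPoly (n : ℕ) : MvPolynomial (Fin 4) ℝ :=
  ∑ i : Fin n, C ((n.choose (i + 1) : ℝ) * varphi (i + 2)) * (X 1 * X 2) ^ (i : ℕ) *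
    momentPoly (n - 1 - i)

open MvPolynomial in
theorem momentPoly_succ (n : ℕ) :
    momentPoly (n + 1) = X 0 * X 1 * X 2 * X 3 * momentBoundPoly n := by
  rw [momentPoly, momentBoundPoly]

open MvPolynomial in
theorem coeff_momentBoundPoly_nonneg {n : ℕ}
    (h : ∀ k ≤ n, ∀ m, 0 ≤ coeff m (momentPoly k)) (m : Fin 4 →₀ ℕ) :
    0 ≤ coeff m (momentBoundPoly n) := by
  rw [momentBoundPoly, coeff_sum]
  refine Finset.sum_nonneg fun i _ => ?_
  have := varphi_nonneg (i + 2)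
  exact coeff_mul_nonneg (coeff_mul_nonneg (coeff_C_nonneg (by positivity))
    (coeff_pow_nonneg (coeff_mul_nonneg (coeff_X_nonneg 1) (coeff_X_nonneg 2)) _))
    (h _ (by omega)) m

open MvPolynomial in
theorem coeff_momentPoly_nonneg (n : ℕ) : ∀ m, 0 ≤ coeff m (momentPoly n) := by
  induction n using Nat.strong_induction_on with
  | _ n ih =>
    cases n with
    | zero => simpa [momentPoly] using coeff_C_nonneg (σ := Fin 4) zero_le_one
    | succ n =>
      rw [momentPoly_succ]
      exact coeff_mul_nonneg
        (coeff_mul_nonneg (coeff_mul_nonneg (coeff_mul_nonneg (coeff_X_nonneg 0)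
          (coeff_X_nonneg 1)) (coeff_X_nonneg 2)) (coeff_X_nonneg 3))
        (coeff_momentBoundPoly_nonneg fun k hk => ih k (by omega))

/-- The linear drift term cancels the `i = 1` summand of the recursion. -/
theorem igOU_recursion_reduced {a b lam T : ℝ} (hlam : 0 < lam) {H : ℕ → ℝ}
    (hH : ∀ h : ℕ, 1 ≤ h →
      H h = (a / b) * ((1 - Real.exp (-(lam * T))) / lam - T) * H (h - 1) +
        ∑ i ∈ Finset.Icc 1 h,
          (lam ^ (i - 1))⁻¹ * (Nat.choose (h - 1) (i - 1) : ℝ) * H (h - i) *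
            (varphi i * a / b ^ (2 * i - 1)) *
            (T + ∑ j ∈ Finset.Icc 1 i,
              (1 / (j : ℝ)) * (Nat.choose i j : ℝ) * (-1 : ℝ) ^ j *
                ((1 - Real.exp (-(lam * ((j : ℝ) * T)))) / lam))) (n : ℕ) :
    H (n + 1) = ∑ i : Fin n, (lam ^ ((i : ℕ) + 1))⁻¹ * (n.choose (i + 1) : ℝ) *
      H (n - 1 - i) * (varphi (i + 2) * a / b ^ (2 * (i : ℕ) + 3)) *
      ∫ s in (0 : ℝ)..T, (1 - Real.exp (-(lam * s))) ^ ((i : ℕ) + 2) := by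
  rw [hH (n + 1) (by omega), ← Finset.Ico_add_one_right_eq_Icc,
    Finset.sum_eq_sum_Ico_succ_bot (by omega), ← add_assoc]
  have hcancel : ∀ x y : ℝ, x = 0 → x + y = y := fun x y hx => by rw [hx, zero_add]
  rw [hcancel]
  · rw [Finset.sum_Ico_eq_sum_range, show n + 1 + 1 - (1 + 1) = n by omega,
      ← Fin.sum_univ_eq_sum_range]
    refine Finset.sum_congr rfl fun i _ => ?_
    rw [add_sum_eq_integral_one_sub_exp_pow hlam, show 1 + 1 + (i : ℕ) = i + 2 by omega,
      show 2 * ((i : ℕ) + 2) - 1 = 2 * i + 3 by omega,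
      show n + 1 - ((i : ℕ) + 2) = n - 1 - i by omega]
    rfl
  · simp [varphi]
    ring

theorem abs_le_momentBoundPoly_of_le {a b lam T : ℝ} (ha : 0 < a) (hb : 0 < b) (hlam : 0 < lam)
    (hT : 0 < T) {H : ℕ → ℝ} {n : ℕ}
    (hH : H (n + 1) = ∑ i : Fin n, (lam ^ ((i : ℕ) + 1))⁻¹ * (n.choose (i + 1) : ℝ) *
      H (n - 1 - i) * (varphi (i + 2) * a / b ^ (2 * (i : ℕ) + 3)) *
      ∫ s in (0 : ℝ)..T, (1 - Real.exp (-(lam * s))) ^ ((i : ℕ) + 2))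
    (h : ∀ k ≤ n, |H k| ≤ MvPolynomial.eval ![a, 1 / lam, 1 / b, T] (momentPoly k) / b ^ k) :
    |H (n + 1)| ≤ a * T / (lam * b ^ (n + 2)) *
      MvPolynomial.eval ![a, 1 / lam, 1 / b, T] (momentBoundPoly n) := by
  rw [hH, momentBoundPoly, map_sum, Finset.mul_sum]
  refine (Finset.abs_sum_le_sum_abs _ _).trans (Finset.sum_le_sum fun i _ => ?_)
  have hφ := varphi_nonneg (i + 2)
  have hk := h (n - 1 - i) (by omega)
  have hint := abs_integral_one_sub_exp_pow_le hlam hT ((i : ℕ) + 2)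
  have hb_pow : b ^ (n + 2) = b ^ (n - 1 - (i : ℕ)) * b ^ ((i : ℕ) + 3) := by
    rw [← pow_add]
    congr 1
    omega
  have hcoef : |varphi (i + 2) * a / b ^ (2 * (i : ℕ) + 3)| =
      varphi (i + 2) * a / b ^ (2 * (i : ℕ) + 3) := abs_of_nonneg (by positivity)
  have hlam_abs : |(lam ^ ((i : ℕ) + 1))⁻¹| = (lam ^ ((i : ℕ) + 1))⁻¹ :=
    abs_of_nonneg (by positivity)
  rw [abs_mul, abs_mul, abs_mul, abs_mul, hcoef, hlam_abs, Nat.abs_cast]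
  calc _ ≤ (lam ^ ((i : ℕ) + 1))⁻¹ * (n.choose (i + 1) : ℝ) *
        (MvPolynomial.eval ![a, 1 / lam, 1 / b, T] (momentPoly (n - 1 - i)) /
          b ^ (n - 1 - (i : ℕ))) * (varphi (i + 2) * a / b ^ (2 * (i : ℕ) + 3)) * T := by
        have := (abs_nonneg _).trans hk
        gcongr
    _ = _ := by
        rw [hb_pow]
        simp [mul_pow]
        field_simp
        ring

/-- For every `N ≥ 1` there is a polynomial `f_N` in four variables with nonnegative real
coefficients, depending only on `N`, such that for all `a, b, λ, T > 0` the sequence `(H_h)`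
built from the inverse Gaussian cumulant function (with `κ⁽ⁱ⁾(0) = φ_i·a/b^{2i−1}` and
`α_{0,t} = (1 − e^{−λt})/λ`) satisfies `|H_N| ≤ (a·T/(λ·b^{N+1})) · f_N(a, 1/λ, 1/b, T)`. -/
theorem igOU_central_moment_bound (N : ℕ) (hN : 1 ≤ N) :
    ∃ f : MvPolynomial (Fin 4) ℝ,
      (∀ mono, 0 ≤ MvPolynomial.coeff mono f) ∧
      ∀ (a b lam T : ℝ), 0 < a → 0 < b → 0 < lam → 0 < T →
        ∀ H : ℕ → ℝ, H 0 = 1 →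
          (∀ h : ℕ, 1 ≤ h →
            H h = (a / b) * ((1 - Real.exp (-(lam * T))) / lam - T) * H (h - 1) +
              ∑ i ∈ Finset.Icc 1 h,
                (lam ^ (i - 1))⁻¹ * (Nat.choose (h - 1) (i - 1) : ℝ) * H (h - i) *
                  (varphi i * a / b ^ (2 * i - 1)) *
                  (T + ∑ j ∈ Finset.Icc 1 i,
                    (1 / (j : ℝ)) * (Nat.choose i j : ℝ) * (-1 : ℝ) ^ j *
                      ((1 - Real.exp (-(lam * ((j : ℝ) * T)))) / lam))) →
          |H N| ≤ a * T / (lam * b ^ (N + 1)) *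
            MvPolynomial.eval ![a, 1 / lam, 1 / b, T] f := by
  obtain ⟨n, rfl⟩ := Nat.exists_eq_add_of_le' hN
  refine ⟨momentBoundPoly n,
    coeff_momentBoundPoly_nonneg fun k _ => coeff_momentPoly_nonneg k, ?_⟩
  intro a b lam T ha hb hlam hT H hH0 hH
  have hred := igOU_recursion_reduced hlam hH
  have hbound : ∀ k, |H k| ≤
      MvPolynomial.eval ![a, 1 / lam, 1 / b, T] (momentPoly k) / b ^ k := by
    intro k
    induction k using Nat.strong_induction_on with
    | _ k ih =>
      cases k with
      | zero => simp [momentPoly, hH0]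
      | succ k =>
        refine (abs_le_momentBoundPoly_of_le ha hb hlam hT (hred k)
          fun j hj => ih j (by omega)).trans_eq ?_
        rw [momentPoly_succ]
        simp
        field_simp
        ring
  exact abs_le_momentBoundPoly_of_le ha hb hlam hT (hred n) fun k _ => hbound k
end

section
/- Let λ > 0, T > 0, c ≥ 0, d ≥ 0, f ∈ ℝ, ρ̃ ∈ ℝ, and let I ⊆ ℝ be an open interval containing 0. Set α_{s,T} = (1 − e^{−λ(T−s)})/λ for s ∈ [0,T]. Suppose κ : ℝ → ℝ is k times continuously differentiable on an open set containing {θ·(c·α_{s,T} + d) + ρ̃ : s ∈ [0,T], θ ∈ I}, and define M(θ) = exp( θ·f − λ·T·κ(ρ̃) + λ·∫₀ᵀ κ(θ·(c·α_{s,T} + d) + ρ̃) ds ) for θ ∈ I. Then the numbers H_h := M^{(h)}(0) satisfy H_0 = 1 and, for every h with 1 ≤ h ≤ k, H_h = f·H_{h−1} + λ·Σ_{i=1}^{h} binom(h−1, i−1)·H_{h−i}·κ^{(i)}(ρ̃)·∫₀ᵀ (c·α_{s,T} + d)^i ds. -/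
/-- The kernel `α_{s,T} = (1 − e^{−λ(T−s)})/λ`. -/
noncomputable def alphaKer (lam T s : ℝ) : ℝ := (1 - Real.exp (-(lam * (T - s)))) / lam

open Set MeasureTheory Topology

theorem exists_forall_norm_le_of_continuousOn_prod {F : ℝ → ℝ → ℝ} {I : Set ℝ} {a b x₀ : ℝ}
    (hI : IsOpen I) (hF : ContinuousOn (Function.uncurry F) (I ×ˢ Icc a b)) (hx₀ : x₀ ∈ I) :
    ∃ s ∈ 𝓝 x₀, s ⊆ I ∧ ∃ C : ℝ, ∀ x ∈ s, ∀ t ∈ Icc a b, ‖F x t‖ ≤ C := by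
  obtain ⟨r, hr, hrI⟩ := Metric.nhds_basis_closedBall.mem_iff.1 (hI.mem_nhds hx₀)
  obtain ⟨C, hC⟩ := ((isCompact_closedBall x₀ r).prod isCompact_Icc).exists_bound_of_continuousOn
    (hF.mono (prod_mono hrI Subset.rfl))
  exact ⟨_, Metric.closedBall_mem_nhds x₀ hr, hrI, C, fun x hx t ht => hC (x, t) ⟨hx, ht⟩⟩

theorem continuousOn_section_of_continuousOn_prod {F : ℝ → ℝ → ℝ} {I : Set ℝ} {a b x : ℝ}
    (hF : ContinuousOn (Function.uncurry F) (I ×ˢ Icc a b)) (hx : x ∈ I) :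
    ContinuousOn (F x) (Icc a b) :=
  hF.comp (f := fun t => (x, t)) (by fun_prop) fun _ ht => ⟨hx, ht⟩

theorem aestronglyMeasurable_section_of_continuousOn_prod {F : ℝ → ℝ → ℝ} {I : Set ℝ} {a b x : ℝ}
    (hab : a ≤ b) (hF : ContinuousOn (Function.uncurry F) (I ×ˢ Icc a b)) (hx : x ∈ I) :
    AEStronglyMeasurable (F x) (volume.restrict (uIoc a b)) := by
  rw [uIoc_of_le hab]
  exact ((continuousOn_section_of_continuousOn_prod hF hx).mono Ioc_subset_Icc_self
    ).aestronglyMeasurable measurableSet_Ioc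

theorem continuousOn_intervalIntegral_of_continuousOn_prod {F : ℝ → ℝ → ℝ} {I : Set ℝ} {a b : ℝ}
    (hab : a ≤ b) (hI : IsOpen I) (hF : ContinuousOn (Function.uncurry F) (I ×ˢ Icc a b)) :
    ContinuousOn (fun x => ∫ t in a..b, F x t) I := by
  intro x₀ hx₀
  obtain ⟨s, hs, hsI, C, hC⟩ := exists_forall_norm_le_of_continuousOn_prod hI hF hx₀
  have hsub : uIoc a b ⊆ Icc a b := by rw [uIoc_of_le hab]; exact Ioc_subset_Icc_self
  refine (intervalIntegral.continuousAt_of_dominated_interval (bound := fun _ => C) ?_ ?_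
    (by simp) ?_).continuousWithinAt
  · filter_upwards [hs] with x hx
    exact aestronglyMeasurable_section_of_continuousOn_prod hab hF (hsI hx)
  · filter_upwards [hs] with x hx
    exact .of_forall fun t ht => hC x hx t (hsub ht)
  · refine .of_forall fun t ht => ContinuousOn.continuousAt ?_ (hI.mem_nhds hx₀)
    exact hF.comp (f := fun x => (x, t)) (by fun_prop) fun _ hx => ⟨hx, hsub ht⟩

theorem hasDerivAt_intervalIntegral_of_continuousOn_prod {F F' : ℝ → ℝ → ℝ} {I : Set ℝ}
    {a b x₀ : ℝ} (hab : a ≤ b) (hI : IsOpen I)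
    (hF : ContinuousOn (Function.uncurry F) (I ×ˢ Icc a b))
    (hF' : ContinuousOn (Function.uncurry F') (I ×ˢ Icc a b))
    (hderiv : ∀ x ∈ I, ∀ t ∈ Icc a b, HasDerivAt (fun y => F y t) (F' x t) x) (hx₀ : x₀ ∈ I) :
    HasDerivAt (fun x => ∫ t in a..b, F x t) (∫ t in a..b, F' x₀ t) x₀ := by
  obtain ⟨s, hs, hsI, C, hC⟩ := exists_forall_norm_le_of_continuousOn_prod hI hF' hx₀
  have hsub : uIoc a b ⊆ Icc a b := by rw [uIoc_of_le hab]; exact Ioc_subset_Icc_self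
  refine (intervalIntegral.hasDerivAt_integral_of_dominated_loc_of_deriv_le (bound := fun _ => C)
    hs ?_ ?_ (aestronglyMeasurable_section_of_continuousOn_prod hab hF' hx₀) ?_ (by simp) ?_).2
  · filter_upwards [hs] with x hx
    exact aestronglyMeasurable_section_of_continuousOn_prod hab hF (hsI hx)
  · exact (continuousOn_section_of_continuousOn_prod hF hx₀).intervalIntegrable_of_Icc hab
  · exact .of_forall fun t ht x hx => hC x hx t (hsub ht)
  · exact .of_forall fun t ht x hx => hderiv x (hsI hx) t (hsub ht)

/-- A chain of functions `g 0, g 1, …, g k`, each the derivative of the previous one, consists of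
the iterated derivatives of its members. -/
theorem contDiffOn_and_iteratedDerivWithin_eq_of_hasDerivAt {g : ℕ → ℝ → ℝ} {I : Set ℝ} {k : ℕ}
    (hI : IsOpen I) (hcont : ∀ j ≤ k, ContinuousOn (g j) I)
    (hderiv : ∀ j < k, ∀ x ∈ I, HasDerivAt (g j) (g (j + 1) x) x) (n j : ℕ) (hjn : j + n ≤ k) :
    ContDiffOn ℝ n (g j) I ∧ EqOn (iteratedDerivWithin n (g j) I) (g (j + n)) I := by
  induction n generalizing j with
  | zero => exact ⟨contDiffOn_zero.2 (hcont j (by lia)), fun x _ => by simp⟩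
  | succ n ih =>
    obtain ⟨hsmooth, heq⟩ := ih (j + 1) (by lia)
    have hd : EqOn (derivWithin (g j) I) (g (j + 1)) I := fun x hx =>
      (hderiv j (by lia) x hx).hasDerivWithinAt.derivWithin (hI.uniqueDiffOn x hx)
    refine ⟨?_, fun x hx => ?_⟩
    · push_cast
      rw [contDiffOn_succ_iff_derivWithin hI.uniqueDiffOn]
      exact ⟨fun x hx => (hderiv j (by lia) x hx).differentiableAt.differentiableWithinAt,
        by simp, hsmooth.congr hd⟩
    · rw [iteratedDerivWithin_succ', iteratedDerivWithin_congr hd hx, heq hx, add_right_comm,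
        add_assoc]

theorem ContDiffOn.hasDerivAt_iteratedDerivWithin {κ : ℝ → ℝ} {U : Set ℝ} {k j : ℕ}
    (hκ : ContDiffOn ℝ k κ U) (hU : IsOpen U) (hj : j < k) {x : ℝ} (hx : x ∈ U) :
    HasDerivAt (iteratedDerivWithin j κ U) (iteratedDerivWithin (j + 1) κ U x) x := by
  rw [iteratedDerivWithin_succ]
  exact ((hκ.differentiableOn_iteratedDerivWithin (by exact_mod_cast hj) hU.uniqueDiffOn) x
    hx).hasDerivWithinAt.hasDerivAt (hU.mem_nhds hx)

/-- Differentiation under the integral sign of `θ ↦ ∫ κ (θ w + ρ)`, up to order `k`. -/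
theorem contDiffOn_and_iteratedDerivWithin_integral_comp_affine {κ w : ℝ → ℝ} {U I : Set ℝ}
    {k : ℕ} {a b ρ : ℝ} (hab : a ≤ b) (hU : IsOpen U) (hI : IsOpen I)
    (hw : ContinuousOn w (Icc a b)) (hmem : ∀ θ ∈ I, ∀ s ∈ Icc a b, θ * w s + ρ ∈ U)
    (hκ : ContDiffOn ℝ k κ U) (n j : ℕ) (hjn : j + n ≤ k) :
    ContDiffOn ℝ n (fun θ => ∫ s in a..b, w s ^ j * iteratedDerivWithin j κ U (θ * w s + ρ)) I ∧
      EqOn (iteratedDerivWithin n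
          (fun θ => ∫ s in a..b, w s ^ j * iteratedDerivWithin j κ U (θ * w s + ρ)) I)
        (fun θ => ∫ s in a..b, w s ^ (j + n) * iteratedDerivWithin (j + n) κ U (θ * w s + ρ)) I := by
  have hcont : ∀ j ≤ k, ContinuousOn (Function.uncurry fun θ s =>
      w s ^ j * iteratedDerivWithin j κ U (θ * w s + ρ)) (I ×ˢ Icc a b) := by
    intro j hj
    have hw' : ContinuousOn (fun p : ℝ × ℝ => w p.2) (I ×ˢ Icc a b) :=
      hw.comp continuousOn_snd fun p hp => hp.2
    exact (hw'.pow j).mul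
      ((hκ.continuousOn_iteratedDerivWithin (by exact_mod_cast hj) hU.uniqueDiffOn).comp
        ((continuousOn_fst.mul hw').add continuousOn_const) fun p hp => hmem p.1 hp.1 p.2 hp.2)
  refine contDiffOn_and_iteratedDerivWithin_eq_of_hasDerivAt (k := k)
    (g := fun j θ => ∫ s in a..b, w s ^ j * iteratedDerivWithin j κ U (θ * w s + ρ)) hI
    (fun j hj => continuousOn_intervalIntegral_of_continuousOn_prod hab hI (hcont j hj))
    (fun j hj θ hθ => hasDerivAt_intervalIntegral_of_continuousOn_prod hab hI (hcont j hj.le)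
      (hcont (j + 1) hj) (fun x hx s hs => ?_) hθ) n j hjn
  have haff : HasDerivAt (fun y => y * w s + ρ) (w s) x := by
    simpa using ((hasDerivAt_id x).mul_const (w s)).add_const ρ
  have hcomp := ((hκ.hasDerivAt_iteratedDerivWithin hU hj (hmem x hx s hs)).comp x
    haff).const_mul (w s ^ j)
  convert! hcomp using 1
  ring

theorem continuous_alphaKer (lam T : ℝ) : Continuous (alphaKer lam T) := by
  unfold alphaKer
  fun_prop

/-- The recursive relationship (4.2) of Lemma 4.1, as a pure calculus statement: with `κ`
`k` times continuously differentiable on an open set `U` containing the relevant points, an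
open interval `I ∋ 0`, and `M(θ) = exp(θ f − λ T κ(ρ̃) + λ ∫₀ᵀ κ(θ(c α_{s,T} + d) + ρ̃) ds)`,
the numbers `H_h := M⁽ʰ⁾(0)` satisfy `H_0 = 1` and, for `1 ≤ h ≤ k`,
`H_h = f H_{h−1} + λ Σ_{i=1}^h C(h−1,i−1) H_{h−i} κ⁽ⁱ⁾(ρ̃) ∫₀ᵀ (c α_{s,T} + d)ⁱ ds`. -/
theorem mgf_moments_recursion
    (lam T c d f ρ : ℝ) (hlam : 0 < lam) (hT : 0 < T) (hc : 0 ≤ c) (hd : 0 ≤ d)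
    (A B : ℝ) (I : Set ℝ) (hI : I = Set.Ioo A B) (h0I : (0 : ℝ) ∈ I)
    (k : ℕ) (κ : ℝ → ℝ) (U : Set ℝ) (hUopen : IsOpen U)
    (hSU : ∀ θ ∈ I, ∀ s ∈ Set.Icc (0 : ℝ) T, θ * (c * alphaKer lam T s + d) + ρ ∈ U)
    (hκ : ContDiffOn ℝ k κ U)
    (M : ℝ → ℝ)
    (hM : ∀ θ : ℝ, M θ = Real.exp (θ * f - lam * T * κ ρ +
      lam * ∫ s in (0 : ℝ)..T, κ (θ * (c * alphaKer lam T s + d) + ρ))) :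
    iteratedDerivWithin 0 M I 0 = 1 ∧
    ∀ h : ℕ, 1 ≤ h → h ≤ k →
      iteratedDerivWithin h M I 0 =
        f * iteratedDerivWithin (h - 1) M I 0 +
          lam * ∑ i ∈ Finset.Icc 1 h,
            (Nat.choose (h - 1) (i - 1) : ℝ) * iteratedDerivWithin (h - i) M I 0 *
              iteratedDerivWithin i κ U ρ *
                ∫ s in (0 : ℝ)..T, (c * alphaKer lam T s + d) ^ i := by
  set w : ℝ → ℝ := fun s => c * alphaKer lam T s + d with hw_def
  have hIo : IsOpen I := hI ▸ isOpen_Ioo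
  have hw : Continuous w := by
    have := continuous_alphaKer lam T
    fun_prop
  have hint := contDiffOn_and_iteratedDerivWithin_integral_comp_affine hT.le hUopen hIo
    hw.continuousOn hSU hκ
  refine ⟨by simp [hM, mul_assoc], fun h h1 hk => ?_⟩
  obtain ⟨n, rfl⟩ : ∃ n, h = n + 1 := ⟨h - 1, by lia⟩
  set G : ℕ → ℝ → ℝ := fun j θ =>
    ∫ s in (0 : ℝ)..T, w s ^ j * iteratedDerivWithin j κ U (θ * w s + ρ) with hG
  have hM_eq : M = fun θ => Real.exp (θ * f - lam * T * κ ρ + lam * G 0 θ) := by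
    funext θ
    simp [hM, hG, hw_def]
  have hG0 : ContDiffOn ℝ ((n + 1 : ℕ)) (G 0) I := (hint (n + 1) 0 (by lia)).1
  have hG1 : ContDiffOn ℝ n (G 1) I := (hint n 1 (by lia)).1
  have hMsmooth : ContDiffOn ℝ ((n + 1 : ℕ)) M I := by
    rw [hM_eq]
    fun_prop
  have hMn : ContDiffOn ℝ n M I := hMsmooth.of_le (by exact_mod_cast n.le_succ)
  have hderiv : EqOn (derivWithin M I) (fun θ => f * M θ + lam * (G 1 * M) θ) I := by
    intro θ hθ
    have hG0θ : HasDerivWithinAt (G 0) (G 1 θ) I θ := by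
      have hd := ((hint 1 0 (by lia)).1.differentiableOn (by simp) θ hθ).hasDerivWithinAt
      rwa [← iteratedDerivWithin_one, (hint 1 0 (by lia)).2 hθ] at hd
    have hlin : HasDerivWithinAt (fun θ => θ * f - lam * T * κ ρ) f I θ := by
      simpa using ((hasDerivAt_id θ).mul_const f).hasDerivWithinAt.sub_const (lam * T * κ ρ)
    have hexp := (hlin.fun_add (hG0θ.const_mul lam)).exp
    have := hexp.derivWithin (hIo.uniqueDiffOn θ hθ)
    rw [hM_eq]
    refine this.trans ?_
    simp only [Pi.mul_apply]
    ring
  have hGn (i : ℕ) (hi : i ≤ n) : iteratedDerivWithin i (G 1) I 0 =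
      iteratedDerivWithin (i + 1) κ U ρ * ∫ s in (0 : ℝ)..T, w s ^ (i + 1) := by
    rw [(hint i 1 (by lia)).2 h0I]
    simp [add_comm 1 i, mul_comm]
  have hGM : ContDiffOn ℝ n (G 1 * M) I := hG1.mul hMn
  have hIu : UniqueDiffOn ℝ I := hIo.uniqueDiffOn
  rw [iteratedDerivWithin_succ', iteratedDerivWithin_congr hderiv h0I,
    iteratedDerivWithin_fun_add h0I hIu (contDiffWithinAt_const.mul (hMn 0 h0I))
      (contDiffWithinAt_const.mul (hGM 0 h0I)),
    iteratedDerivWithin_const_mul_field, iteratedDerivWithin_const_mul_field,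
    iteratedDerivWithin_mul h0I hIu (hG1 0 h0I) (hMn 0 h0I), ← Finset.Ico_add_one_right_eq_Icc,
    Finset.sum_Ico_eq_sum_range]
  congr 2
  refine Finset.sum_congr (by simp) fun i hi => ?_
  rw [hGn i (by simp at hi; lia), add_comm 1 i]
  simp only [Nat.add_sub_cancel, Nat.add_sub_add_right, hw_def]
  ring
end

section
/- For all x > 0 and y > 0: ∂³BS_Put/∂x³ (x,y) = −(φ(d_+(x,y))/(x²·y))·(d_+(x,y) + √y). -/
/-- Density of the standard normal distribution. -/
noncomputable def stdGaussianPDF (z : ℝ) : ℝ :=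
  (Real.sqrt (2 * Real.pi))⁻¹ * Real.exp (-z ^ 2 / 2)

/-- Cumulative distribution function of the standard normal distribution. -/
noncomputable def stdGaussianCDF (z : ℝ) : ℝ :=
  ∫ t in Set.Iic z, stdGaussianPDF t

/-- d₊ from the Black–Scholes formula. -/
noncomputable def dPlus (K r T x y : ℝ) : ℝ :=
  (Real.log (x / K) + r * T + y / 2) / Real.sqrt y

/-- d₋ from the Black–Scholes formula. -/
noncomputable def dMinus (K r T x y : ℝ) : ℝ :=
  (Real.log (x / K) + r * T - y / 2) / Real.sqrt y

/-- Black–Scholes put price with strike `K`, interest rate `r`, maturity `T`,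
spot `x` and integrated variance `y`. -/
noncomputable def BSPut (K r T x y : ℝ) : ℝ :=
  K * Real.exp (-(r * T)) * stdGaussianCDF (-(dMinus K r T x y)) -
    x * stdGaussianCDF (-(dPlus K r T x y))

theorem continuous_stdGaussianPDF : Continuous stdGaussianPDF := by
  unfold stdGaussianPDF
  fun_prop

theorem integrable_stdGaussianPDF : MeasureTheory.Integrable stdGaussianPDF := by
  unfold stdGaussianPDF
  refine MeasureTheory.Integrable.const_mul ?_ _
  convert integrable_exp_neg_mul_sq (b := 1 / 2) (by norm_num) using 3
  ring

theorem stdGaussianPDF_neg (z : ℝ) : stdGaussianPDF (-z) = stdGaussianPDF z := by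
  simp [stdGaussianPDF]

theorem hasDerivAt_stdGaussianPDF (z : ℝ) :
    HasDerivAt stdGaussianPDF (-z * stdGaussianPDF z) z := by
  unfold stdGaussianPDF
  refine HasDerivAt.congr_deriv ((((hasDerivAt_id' z).pow 2).neg.div_const 2).exp.const_mul
    (Real.sqrt (2 * Real.pi))⁻¹) ?_
  simp
  ring

theorem hasDerivAt_stdGaussianCDF (z : ℝ) :
    HasDerivAt stdGaussianCDF (stdGaussianPDF z) z := by
  have h_eq : stdGaussianCDF =
      fun z => stdGaussianCDF 0 + ∫ t in (0 : ℝ)..z, stdGaussianPDF t := by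
    funext w
    rw [← intervalIntegral.integral_Iic_sub_Iic integrable_stdGaussianPDF.integrableOn
      integrable_stdGaussianPDF.integrableOn]
    simp [stdGaussianCDF]
  rw [h_eq]
  exact (continuous_stdGaussianPDF.integral_hasStrictDerivAt 0 z).hasDerivAt.const_add _

theorem hasDerivAt_log_div {K x : ℝ} (hK : K ≠ 0) (hx : x ≠ 0) :
    HasDerivAt (fun x => Real.log (x / K)) (1 / x) x := by
  refine HasDerivAt.congr_deriv (((hasDerivAt_id' x).div_const K).log (div_ne_zero hx hK)) ?_
  field_simp

theorem hasDerivAt_dPlus {K x : ℝ} (r T y : ℝ) (hK : K ≠ 0) (hx : x ≠ 0) :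
    HasDerivAt (fun x => dPlus K r T x y) (1 / x / Real.sqrt y) x :=
  (((hasDerivAt_log_div hK hx).add_const _).add_const _).div_const _

theorem hasDerivAt_dMinus {K x : ℝ} (r T y : ℝ) (hK : K ≠ 0) (hx : x ≠ 0) :
    HasDerivAt (fun x => dMinus K r T x y) (1 / x / Real.sqrt y) x :=
  (((hasDerivAt_log_div hK hx).add_const _).sub_const _).div_const _

/-- The discounted strike and the spot have the same Gaussian weight. -/
theorem strike_mul_stdGaussianPDF_dMinus {K x y : ℝ} (r T : ℝ) (hK : 0 < K) (hx : 0 < x)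
    (hy : 0 < y) :
    K * Real.exp (-(r * T)) * stdGaussianPDF (dMinus K r T x y) =
      x * stdGaussianPDF (dPlus K r T x y) := by
  have h_sq : -dMinus K r T x y ^ 2 / 2 =
      -dPlus K r T x y ^ 2 / 2 + Real.log (x / K) + r * T := by
    unfold dMinus dPlus
    rw [div_pow, div_pow, Real.sq_sqrt hy.le]
    field_simp
    ring
  have h_exp : Real.exp (-(r * T)) * Real.exp (r * T) = 1 := by
    rw [← Real.exp_add]
    simp
  unfold stdGaussianPDF
  rw [h_sq, Real.exp_add, Real.exp_add, Real.exp_log (div_pos hx hK)]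
  field_simp
  linear_combination h_exp

/-- The delta of the put. -/
theorem hasDerivAt_BSPut {K x y : ℝ} (r T : ℝ) (hK : 0 < K) (hx : 0 < x) (hy : 0 < y) :
    HasDerivAt (fun x => BSPut K r T x y) (-stdGaussianCDF (-dPlus K r T x y)) x := by
  have h_minus := (hasDerivAt_stdGaussianCDF _).comp x
    (hasDerivAt_dMinus r T y hK.ne' hx.ne').neg
  have h_plus := (hasDerivAt_stdGaussianCDF _).comp x
    (hasDerivAt_dPlus r T y hK.ne' hx.ne').neg
  refine HasDerivAt.congr_deriv ((h_minus.const_mul (K * Real.exp (-(r * T)))).sub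
    ((hasDerivAt_id' x).mul h_plus)) ?_
  simp only [Pi.neg_apply, stdGaussianPDF_neg]
  linear_combination -(1 / x / Real.sqrt y) * strike_mul_stdGaussianPDF_dMinus r T hK hx hy

/-- The gamma of the put, as the derivative of its delta. -/
theorem hasDerivAt_delta {K x : ℝ} (r T y : ℝ) (hK : K ≠ 0) (hx : x ≠ 0) :
    HasDerivAt (fun x => -stdGaussianCDF (-dPlus K r T x y))
      (stdGaussianPDF (dPlus K r T x y) / (x * Real.sqrt y)) x := by
  refine HasDerivAt.congr_deriv ((hasDerivAt_stdGaussianCDF _).comp x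
    (hasDerivAt_dPlus r T y hK hx).neg).neg ?_
  simp only [Pi.neg_apply, stdGaussianPDF_neg]
  ring

/-- The derivative of the gamma of the put. -/
theorem hasDerivAt_gamma {K x y : ℝ} (r T : ℝ) (hK : K ≠ 0) (hx : x ≠ 0) (hy : 0 < y) :
    HasDerivAt (fun x => stdGaussianPDF (dPlus K r T x y) / (x * Real.sqrt y))
      (-(stdGaussianPDF (dPlus K r T x y) / (x ^ 2 * y)) *
        (dPlus K r T x y + Real.sqrt y)) x := by
  have h_sqrt : Real.sqrt y ≠ 0 := (Real.sqrt_pos.2 hy).ne'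
  refine HasDerivAt.congr_deriv
    (((hasDerivAt_stdGaussianPDF _).comp x (hasDerivAt_dPlus r T y hK hx)).div
      ((hasDerivAt_id' x).mul_const (Real.sqrt y)) (mul_ne_zero hx h_sqrt)) ?_
  simp only [Function.comp_apply]
  field_simp
  rw [Real.sq_sqrt hy.le]
  ring

/-- Third derivative in the spot variable (formula (5.1)):
`∂³BS_Put/∂x³ = −(φ(d₊)/(x²y))·(d₊ + √y)` for all `x, y > 0`. -/
theorem bsPut_third_partial_xxx (K r T : ℝ) (hK : 0 < K) (hT : 0 < T) :
    ∀ x y : ℝ, 0 < x → 0 < y →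
      iteratedDeriv 3 (fun x' => BSPut K r T x' y) x =
        -(stdGaussianPDF (dPlus K r T x y) / (x ^ 2 * y)) *
          (dPlus K r T x y + Real.sqrt y) := by
  intro x y hx hy
  have h_delta : Set.EqOn (deriv fun x => BSPut K r T x y)
      (fun x => -stdGaussianCDF (-dPlus K r T x y)) (Set.Ioi 0) :=
    fun z hz => (hasDerivAt_BSPut r T hK hz hy).deriv
  have h_gamma : Set.EqOn (deriv (deriv fun x => BSPut K r T x y))
      (fun x => stdGaussianPDF (dPlus K r T x y) / (x * Real.sqrt y)) (Set.Ioi 0) :=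
    fun z hz => (h_delta.deriv isOpen_Ioi hz).trans
      (hasDerivAt_delta r T y hK.ne' (ne_of_gt hz)).deriv
  simp only [iteratedDeriv_succ, iteratedDeriv_zero]
  exact (h_gamma.deriv isOpen_Ioi hx).trans (hasDerivAt_gamma r T hK.ne' hx.ne' hy).deriv
end
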